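/- In a family of domino tableaux of rank r obtained from one another by moving through sets of non-core open cycles, there is exactly one somewhat special tableau. -/

import Mathlib

/-- A standard domino tableau of rank `r` with `n` dominoes (1-indexed squares
`S_{i,j}`, `i,j ≥ 1`): the staircase core `{S_{i,j} : i+j < r+2}` is labeled `0`,
each label `1, …, n` occupies exactly two adjacent squares, labels increase
weakly along rows and columns, and the underlying shape is a Young diagram. -/
structure SDT (r n : ℕ) where
  cells : Finset (ℕ × ℕ)
  lab : ℕ × ℕ → ℕ
  lab_outside : ∀ c, c ∉ cells → lab c = 0
  pos_cells : ∀ c ∈ cells, 1 ≤ c.1 ∧ 1 ≤ c.2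
  young_row : ∀ i j : ℕ, (i, j + 1) ∈ cells → 1 ≤ j → (i, j) ∈ cells
  young_col : ∀ i j : ℕ, (i + 1, j) ∈ cells → 1 ≤ i → (i, j) ∈ cells
  core_mem : ∀ i j : ℕ, 1 ≤ i → 1 ≤ j → i + j < r + 2 → (i, j) ∈ cells
  core_zero : ∀ c ∈ cells, (lab c = 0 ↔ c.1 + c.2 < r + 2)
  lab_le : ∀ c ∈ cells, lab c ≤ n
  domino : ∀ k : ℕ, 1 ≤ k → k ≤ n → ∃ a b : ℕ × ℕ, a ∈ cells ∧ b ∈ cells ∧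
    (b = (a.1 + 1, a.2) ∨ b = (a.1, a.2 + 1)) ∧ lab a = k ∧ lab b = k ∧
    ∀ c ∈ cells, lab c = k → c = a ∨ c = b
  row_mono : ∀ i j : ℕ, (i, j) ∈ cells → (i, j + 1) ∈ cells →
    lab (i, j) ≤ lab (i, j + 1)
  col_mono : ∀ i j : ℕ, (i, j) ∈ cells → (i + 1, j) ∈ cells →
    lab (i, j) ≤ lab (i + 1, j)

/-- The support of the domino labeled `k` in `T`. -/
def SDT.supp {r n : ℕ} (T : SDT r n) (k : ℕ) : Finset (ℕ × ℕ) :=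
  T.cells.filter (fun c => T.lab c = k)

/-- A square `S_{i,j}` is fixed if `i + j` has the opposite parity to `r`. -/
def FixedSq (r : ℕ) (c : ℕ × ℕ) : Prop := (c.1 + c.2) % 2 ≠ r % 2

/-- A square is variable if it is not fixed, i.e. `i + j ≡ r (mod 2)`. -/
def VariableSq (r : ℕ) (c : ℕ × ℕ) : Prop := (c.1 + c.2) % 2 = r % 2

/-- A variable square in an odd row is of type `X`. -/
def TypeX (r : ℕ) (c : ℕ × ℕ) : Prop := VariableSq r c ∧ c.1 % 2 = 1

/-- Extended label: `0` on squares with a vanishing coordinate (i.e. `i ≤ 0` or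
`j ≤ 0`), `∞` on positive squares outside `T`, and the label of `T` otherwise. -/
def SDT.labE {r n : ℕ} (T : SDT r n) (c : ℕ × ℕ) : ℕ∞ :=
  if c.1 = 0 ∨ c.2 = 0 then 0 else if c ∈ T.cells then (T.lab c : ℕ∞) else ⊤

/-- Garfinkle's `D'(k,T)`: `s` is the support of the image of the domino labeled
`k` under moving through, defined by the case analysis on the position of the
fixed square of the domino. -/
def IsSuppD' {r n : ℕ} (T : SDT r n) (k : ℕ) (s : Finset (ℕ × ℕ)) : Prop :=
  ∃ i j : ℕ, FixedSq r (i, j) ∧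
    (((T.supp k = {(i, j), (i + 1, j)} ∨ T.supp k = {(i, j - 1), (i, j)}) ∧
        (((k : ℕ∞) < T.labE (i - 1, j + 1) ∧ s = {(i, j), (i - 1, j)}) ∨
         (T.labE (i - 1, j + 1) < (k : ℕ∞) ∧ s = {(i, j), (i, j + 1)}))) ∨
     ((T.supp k = {(i, j), (i - 1, j)} ∨ T.supp k = {(i, j + 1), (i, j)}) ∧
        (((k : ℕ∞) < T.labE (i + 1, j - 1) ∧ s = {(i, j), (i, j - 1)}) ∨
         (T.labE (i + 1, j - 1) < (k : ℕ∞) ∧ s = {(i, j), (i + 1, j)}))))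

open Classical in
/-- The support of `D'(k,T)`. -/
noncomputable def suppD' {r n : ℕ} (T : SDT r n) (k : ℕ) : Finset (ℕ × ℕ) :=
  if h : ∃ s, IsSuppD' T k s then h.choose else ∅

/-- One step of the relation generating the cycle: `l` and `m` interact if
`supp D(l) ∩ supp D'(m) ≠ ∅` or `supp D'(l) ∩ supp D(m) ≠ ∅`. -/
noncomputable def cycStep {r n : ℕ} (T : SDT r n) (m l : ℕ) : Prop :=
  (T.supp l ∩ suppD' T m).Nonempty ∨ (suppD' T l ∩ T.supp m).Nonempty

/-- The cycle `c(k,T)` through `k`: all labels of `T` reachable from `k` by the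
interaction relation. -/
noncomputable def cyc {r n : ℕ} (T : SDT r n) (k : ℕ) : Set ℕ :=
  {l | 1 ≤ l ∧ l ≤ n ∧ Relation.ReflTransGen (cycStep T) k l}

/-- `T'` is obtained from `T` by moving through the set of labels `c`: dominoes
in `c` move to their `D'` positions, all others stay. -/
noncomputable def IsMT {r n : ℕ} (T T' : SDT r n) (c : Set ℕ) : Prop :=
  (∀ l ∈ c, T'.supp l = suppD' T l) ∧
  ∀ l : ℕ, 1 ≤ l → l ≤ n → l ∉ c → T'.supp l = T.supp l

/-- `c` is a cycle of `T`. -/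
noncomputable def IsCycle {r n : ℕ} (T : SDT r n) (c : Set ℕ) : Prop :=
  ∃ k : ℕ, 1 ≤ k ∧ k ≤ n ∧ c = cyc T k

/-- `c` is a non-core open cycle of `T`: moving through it yields a rank-`r`
tableau (so the core is unchanged) of a different shape. -/
noncomputable def NonCoreOpen {r n : ℕ} (T : SDT r n) (c : Set ℕ) : Prop :=
  IsCycle T c ∧ ∃ T' : SDT r n, IsMT T T' c ∧ T'.cells ≠ T.cells

/-- A set of squares is boxed if it is contained in a block
`{S_{i,j}, S_{i+1,j}, S_{i,j+1}, S_{i+1,j+1}}` with `S_{i,j}` of type `X`. -/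
def BoxedSet (r : ℕ) (s : Finset (ℕ × ℕ)) : Prop :=
  ∃ i j : ℕ, TypeX r (i, j) ∧
    ↑s ⊆ ({(i, j), (i + 1, j), (i, j + 1), (i + 1, j + 1)} : Set (ℕ × ℕ))

/-- A domino tableau is somewhat special if all its non-core open cycles are
boxed. -/
noncomputable def SomewhatSpecial {r n : ℕ} (T : SDT r n) : Prop :=
  ∀ c, NonCoreOpen T c → ∀ l ∈ c, BoxedSet r (T.supp l)

namespace SDTaux

variable {r n : ℕ}

theorem mem_supp (A : SDT r n) (k : ℕ) (x : ℕ × ℕ) : x ∈ A.supp k ↔ x ∈ A.cells ∧ A.lab x = k := by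
  simp [SDT.supp]

theorem mem_supp_iff (A : SDT r n) {k : ℕ} (hk : 1 ≤ k) (x : ℕ × ℕ) :
    x ∈ A.supp k ↔ A.labE x = k := by
  rw [mem_supp]
  unfold SDT.labE
  constructor
  · rintro ⟨h1, h2⟩
    have := A.pos_cells x h1
    rw [if_neg (by omega), if_pos h1, h2]
  · intro h
    split_ifs at h with h1 h2
    · exfalso
      have : (0 : ℕ) = k := by exact_mod_cast h
      omega
    · exact ⟨h2, by exact_mod_cast h⟩
    · exact absurd h.symm (ENat.natCast_ne_top k)

theorem row_le (A : SDT r n) (i j : ℕ) : A.labE (i, j) ≤ A.labE (i, j + 1) := by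
  unfold SDT.labE
  by_cases h : i = 0 ∨ j = 0
  · simp [h]
  · by_cases h2 : (i, j + 1) ∈ A.cells
    · have h3 := A.young_row i j h2 (by omega)
      have := A.row_mono i j h3 h2
      simp [h2, h3]
      split_ifs <;> simp_all
    · simp [h2]
      split_ifs <;> simp_all

theorem col_le (A : SDT r n) (i j : ℕ) : A.labE (i, j) ≤ A.labE (i + 1, j) := by
  unfold SDT.labE
  by_cases h : i = 0 ∨ j = 0
  · simp [h]
  · by_cases h2 : (i + 1, j) ∈ A.cells
    · have h3 := A.young_col i j h2 (by omega)
      have := A.col_mono i j h3 h2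
      simp [h2, h3]
      split_ifs <;> simp_all
    · simp [h2]
      split_ifs <;> simp_all

theorem labE_zero (A : SDT r n) (i j : ℕ) (h : i = 0 ∨ j = 0 ∨ i + j < r + 2) :
    A.labE (i, j) = 0 := by
  unfold SDT.labE
  by_cases h1 : i = 0 ∨ j = 0
  · simp [h1]
  · have h2 : (i, j) ∈ A.cells := A.core_mem i j (by omega) (by omega) (by omega)
    have := (A.core_zero _ h2).2 (show i + j < r + 2 by omega)
    simp [h2, this]

open Classical in
/-- The north-east variable position. -/
noncomputable def vNE (A : SDT r n) (p q k : ℕ) : ℕ × ℕ :=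
  if (k : ℕ∞) < A.labE (p, q + 2) then (p, q + 1) else (p + 1, q + 2)

open Classical in
/-- The south-west variable position. -/
noncomputable def vSW (A : SDT r n) (p q k : ℕ) : ℕ × ℕ :=
  if (k : ℕ∞) < A.labE (p + 2, q) then (p + 1, q) else (p + 2, q + 1)

theorem suppD'_eq (A : SDT r n) (k : ℕ) (s : Finset (ℕ × ℕ)) (h : IsSuppD' A k s)
    (hu : ∀ t, IsSuppD' A k t → t = s) : suppD' A k = s := by
  unfold suppD'
  have h' : ∃ s, IsSuppD' A k s := ⟨s, h⟩
  rw [dif_pos h']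
  exact hu _ h'.choose_spec

theorem labE_ne (A : SDT r n) {k p q : ℕ} (hk : 1 ≤ k) {w x : ℕ × ℕ}
    (hs : A.supp k = {w, x}) (h1 : (p, q) ≠ w) (h2 : (p, q) ≠ x) : A.labE (p, q) ≠ k := by
  intro h
  rw [← mem_supp_iff A hk, hs] at h
  simp at h
  tauto

theorem D'_of (A : SDT r n) {k p q : ℕ} (hk : 1 ≤ k) (hf : FixedSq r (p + 1, q + 1))
    {w : ℕ × ℕ} (hs : A.supp k = {(p + 1, q + 1), w}) :
    ((w = (p + 2, q + 1) ∨ w = (p + 1, q)) → suppD' A k = {(p + 1, q + 1), vNE A p q k}) ∧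
    ((w = (p, q + 1) ∨ w = (p + 1, q + 2)) → suppD' A k = {(p + 1, q + 1), vSW A p q k}) := by
  have key : ∀ i j : ℕ, FixedSq r (i, j) → (i, j) ∈ A.supp k → (w.1 + w.2) % 2 = r % 2 →
      i = p + 1 ∧ j = q + 1 := by
    intro i j h1 h2 h3
    rw [hs] at h2
    simp only [Finset.mem_insert, Finset.mem_singleton, Prod.ext_iff] at h2
    unfold FixedSq at h1
    simp only at h1 h2
    rcases h2 with h2 | h2
    · exact h2
    · rw [← h2.1, ← h2.2] at h3; exact absurd h3 h1
  have hf' : (p + 1 + (q + 1)) % 2 ≠ r % 2 := hf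
  have wmem : w ∈ A.supp k := by rw [hs]; simp
  constructor
  · intro hw
    have hwv : (w.1 + w.2) % 2 = r % 2 := by
      rcases hw with rfl | rfl <;> simp only <;> omega
    have hne : A.labE (p, q + 2) ≠ k := by
      apply labE_ne A hk hs
      · simp
      · rcases hw with rfl | rfl <;> simp
    apply suppD'_eq
    · refine ⟨p + 1, q + 1, hf, Or.inl ⟨?_, ?_⟩⟩
      · rcases hw with rfl | rfl
        · left; exact hs
        · right; rw [hs, Finset.pair_comm]; rfl
      · unfold vNE
        split_ifs with h
        · left; exact ⟨h, rfl⟩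
        · right; exact ⟨lt_of_le_of_ne (not_lt.1 h) hne, rfl⟩
    · rintro t ⟨i, j, hij, H⟩
      rcases H with ⟨hc, H⟩ | ⟨hc, H⟩
      · obtain ⟨rfl, rfl⟩ := key i j hij (by rcases hc with hc | hc <;> rw [hc] <;> simp) hwv
        simp only [Nat.add_sub_cancel] at H
        unfold vNE
        rcases H with ⟨h, rfl⟩ | ⟨h, rfl⟩
        · rw [if_pos h]
        · rw [if_neg (not_lt.2 h.le)]
      · exfalso
        obtain ⟨rfl, rfl⟩ := key i j hij (by rcases hc with hc | hc <;> rw [hc] <;> simp) hwv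
        rcases hc with hc | hc <;> rw [hc] at wmem <;> rcases hw with rfl | rfl <;>
          simp at wmem <;> omega
  · intro hw
    have hwv : (w.1 + w.2) % 2 = r % 2 := by
      rcases hw with rfl | rfl <;> simp only <;> omega
    have hne : A.labE (p + 2, q) ≠ k := by
      apply labE_ne A hk hs
      · simp
      · rcases hw with rfl | rfl <;> simp
    apply suppD'_eq
    · refine ⟨p + 1, q + 1, hf, Or.inr ⟨?_, ?_⟩⟩
      · rcases hw with rfl | rfl
        · left; exact hs
        · right; rw [hs, Finset.pair_comm]
      · unfold vSW
        split_ifs with h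
        · left; exact ⟨h, rfl⟩
        · right; exact ⟨lt_of_le_of_ne (not_lt.1 h) hne, rfl⟩
    · rintro t ⟨i, j, hij, H⟩
      rcases H with ⟨hc, H⟩ | ⟨hc, H⟩
      · exfalso
        obtain ⟨rfl, rfl⟩ := key i j hij (by rcases hc with hc | hc <;> rw [hc] <;> simp) hwv
        rcases hc with hc | hc <;> rw [hc] at wmem <;> rcases hw with rfl | rfl <;>
          simp at wmem <;> omega
      · obtain ⟨rfl, rfl⟩ := key i j hij (by rcases hc with hc | hc <;> rw [hc] <;> simp) hwv
        simp only [Nat.add_sub_cancel] at H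
        unfold vSW
        rcases H with ⟨h, rfl⟩ | ⟨h, rfl⟩
        · rw [if_pos h]
        · rw [if_neg (not_lt.2 h.le)]

/-- Which of the two positions is occupied. -/
def Pos (A : SDT r n) (k p q : ℕ) : Prop :=
  FixedSq r (p + 1, q + 1) ∧
    ((A.supp k = {(p + 1, q + 1), vNE A p q k} ∧ suppD' A k = {(p + 1, q + 1), vSW A p q k}) ∨
     (A.supp k = {(p + 1, q + 1), vSW A p q k} ∧ suppD' A k = {(p + 1, q + 1), vNE A p q k}))

theorem pos_of (A : SDT r n) {k p q : ℕ} (hk : 1 ≤ k) (hf : FixedSq r (p + 1, q + 1))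
    {w : ℕ × ℕ} (hs : A.supp k = {(p + 1, q + 1), w})
    (hw : w = (p + 2, q + 1) ∨ w = (p + 1, q) ∨ w = (p, q + 1) ∨ w = (p + 1, q + 2)) :
    Pos A k p q := by
  refine ⟨hf, ?_⟩
  have hD := D'_of A hk hf hs
  have hwl : A.labE w = k := by rw [← mem_supp_iff A hk, hs]; simp
  have hwc : w ∈ A.cells := by
    have : w ∈ A.supp k := by rw [hs]; simp
    exact ((mem_supp A k w).1 this).1
  have hwp := A.pos_cells w hwc
  have hne1 : w = (p, q + 1) ∨ w = (p + 1, q + 2) → A.labE (p, q + 2) ≠ k := by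
    intro hw
    apply labE_ne A hk hs
    · simp
    · rcases hw with rfl | rfl <;> simp
  have hne2 : w = (p + 2, q + 1) ∨ w = (p + 1, q) → A.labE (p + 2, q) ≠ k := by
    intro hw
    apply labE_ne A hk hs
    · simp
    · rcases hw with rfl | rfl <;> simp
  rcases hw with hw | hw | hw | hw
  · right
    refine ⟨?_, hD.1 (Or.inl hw)⟩
    have h1 : ¬ (k : ℕ∞) < A.labE (p + 2, q) := by
      rw [not_lt, ← hwl, hw]; exact row_le A _ _
    rw [hs, vSW, if_neg h1, hw]
  · right
    refine ⟨?_, hD.1 (Or.inr hw)⟩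
    have h1 : (k : ℕ∞) < A.labE (p + 2, q) := by
      refine lt_of_le_of_ne ?_ (hne2 (Or.inr hw)).symm
      rw [← hwl, hw]; exact col_le A _ _
    rw [hs, vSW, if_pos h1, hw]
  · left
    refine ⟨?_, hD.2 (Or.inl hw)⟩
    have h1 : (k : ℕ∞) < A.labE (p, q + 2) := by
      refine lt_of_le_of_ne ?_ (hne1 (Or.inl hw)).symm
      rw [← hwl, hw]; exact row_le A _ _
    rw [hs, vNE, if_pos h1, hw]
  · left
    refine ⟨?_, hD.2 (Or.inr hw)⟩
    have h1 : ¬ (k : ℕ∞) < A.labE (p, q + 2) := by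
      rw [not_lt, ← hwl, hw]; exact col_le A _ _
    rw [hs, vNE, if_neg h1, hw]

theorem pos_cases (A : SDT r n) {k : ℕ} (hk : 1 ≤ k) (hkn : k ≤ n) : ∃ p q, Pos A k p q := by
  obtain ⟨⟨a1, a2⟩, b, ha, hb, hab, la, lb, hu⟩ := A.domino k hk hkn
  have hs : A.supp k = {(a1, a2), b} := by
    ext x
    rw [mem_supp]
    simp only [Finset.mem_insert, Finset.mem_singleton]
    constructor
    · rintro ⟨h1, h2⟩; exact hu x h1 h2
    · rintro (rfl | rfl)
      · exact ⟨ha, la⟩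
      · exact ⟨hb, lb⟩
  have hpa := A.pos_cells _ ha
  have hpb := A.pos_cells _ hb
  simp only at hpa hab
  obtain ⟨p, rfl⟩ : ∃ p, a1 = p + 1 := ⟨a1 - 1, by omega⟩
  obtain ⟨q, rfl⟩ : ∃ q, a2 = q + 1 := ⟨a2 - 1, by omega⟩
  by_cases hf : FixedSq r (p + 1, q + 1)
  · exact ⟨p, q, pos_of A hk hf hs (by tauto)⟩
  · rw [Finset.pair_comm] at hs
    unfold FixedSq at hf
    simp only [ne_eq, not_not] at hf
    rcases hab with rfl | rfl
    · refine ⟨p + 1, q, pos_of A hk ?_ hs (by tauto)⟩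
      unfold FixedSq; simp only; omega
    · refine ⟨p, q + 1, pos_of A hk ?_ hs (by tauto)⟩
      unfold FixedSq; simp only; omega

theorem vNE_cases (A : SDT r n) (p q k : ℕ) : 
    ((k : ℕ∞) < A.labE (p, q + 2) ∧ 1 ≤ p ∧ vNE A p q k = (p, q + 1)) ∨
    (A.labE (p, q + 2) ≤ k ∧ vNE A p q k = (p + 1, q + 2)) := by
  unfold vNE
  split_ifs with h
  · left
    refine ⟨h, ?_, rfl⟩
    by_contra h0
    rw [labE_zero A p _ (by omega)] at h
    exact absurd h (by simp)
  · right; exact ⟨not_lt.1 h, rfl⟩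

theorem vSW_cases (A : SDT r n) (p q k : ℕ) : 
    ((k : ℕ∞) < A.labE (p + 2, q) ∧ 1 ≤ q ∧ vSW A p q k = (p + 1, q)) ∨
    (A.labE (p + 2, q) ≤ k ∧ vSW A p q k = (p + 2, q + 1)) := by
  unfold vSW
  split_ifs with h
  · left
    refine ⟨h, ?_, rfl⟩
    by_contra h0
    rw [labE_zero A (p + 2) q (by omega)] at h
    exact absurd h (by simp)
  · right; exact ⟨not_lt.1 h, rfl⟩

theorem vNE_var (A : SDT r n) {p q k : ℕ} (hf : FixedSq r (p + 1, q + 1)) :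
    ¬ FixedSq r (vNE A p q k) := by
  unfold FixedSq at *
  simp only at hf
  rcases vNE_cases A p q k with ⟨_, _, h⟩ | ⟨_, h⟩ <;> rw [h] <;> simp only <;> omega

theorem vSW_var (A : SDT r n) {p q k : ℕ} (hf : FixedSq r (p + 1, q + 1)) :
    ¬ FixedSq r (vSW A p q k) := by
  unfold FixedSq at *
  simp only at hf
  rcases vSW_cases A p q k with ⟨_, _, h⟩ | ⟨_, h⟩ <;> rw [h] <;> simp only <;> omega

theorem vNE_ne_vSW (A B : SDT r n) (p q k : ℕ) : vNE A p q k ≠ vSW B p q k := by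
  rcases vNE_cases A p q k with ⟨_, _, h⟩ | ⟨_, h⟩ <;>
  rcases vSW_cases B p q k with ⟨_, _, h'⟩ | ⟨_, h'⟩ <;> rw [h, h'] <;> simp

theorem fixed_mem (A : SDT r n) {k : ℕ} (hk : 1 ≤ k) (hkn : k ≤ n) {x : ℕ × ℕ}
    (hx : FixedSq r x) : x ∈ suppD' A k ↔ x ∈ A.supp k := by
  obtain ⟨p, q, hf, h⟩ := pos_cases A hk hkn
  have h1 : x ≠ vNE A p q k := fun h => vNE_var A hf (h ▸ hx)
  have h2 : x ≠ vSW A p q k := fun h => vSW_var A hf (h ▸ hx)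
  rcases h with ⟨h3, h4⟩ | ⟨h3, h4⟩ <;> rw [h3, h4] <;> simp [h1, h2]

theorem var_not_both (A : SDT r n) {k : ℕ} (hk : 1 ≤ k) (hkn : k ≤ n) {x : ℕ × ℕ}
    (hx : ¬ FixedSq r x) (h5 : x ∈ A.supp k) (h6 : x ∈ suppD' A k) : False := by
  obtain ⟨p, q, hf, h⟩ := pos_cases A hk hkn
  have h1 : x ≠ (p + 1, q + 1) := fun h => hx (h ▸ hf)
  have h2 := vNE_ne_vSW A A p q k
  rcases h with ⟨h3, h4⟩ | ⟨h3, h4⟩ <;> rw [h3] at h5 <;> rw [h4] at h6 <;>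
    simp [h1] at h5 h6 <;> rw [h5] at h6
  · exact h2 h6
  · exact h2 h6.symm

theorem noncore (A : SDT r n) {k : ℕ} (hk : 1 ≤ k) (hkn : k ≤ n) {x : ℕ × ℕ}
    (h6 : x ∈ suppD' A k) : r + 2 ≤ x.1 + x.2 := by
  obtain ⟨p, q, hf, h⟩ := pos_cases A hk hkn
  have h7 : (p + 1, q + 1) ∈ A.supp k := by
    rcases h with ⟨h3, h4⟩ | ⟨h3, h4⟩ <;> rw [h3] <;> simp
  rw [mem_supp] at h7
  have h8 := A.core_zero _ h7.1
  rw [h7.2] at h8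
  unfold FixedSq at hf
  simp only at hf h8
  have h9 : x = (p + 1, q + 1) ∨ x = vSW A p q k ∨ x = vNE A p q k := by
    rcases h with ⟨h3, h4⟩ | ⟨h3, h4⟩ <;> rw [h4] at h6 <;> simp at h6 <;> tauto
  rcases h9 with rfl | rfl | rfl
  · simp only; omega
  · rcases vSW_cases A p q k with ⟨_, _, h⟩ | ⟨_, h⟩ <;> rw [h] <;> simp only <;> omega
  · rcases vNE_cases A p q k with ⟨_, _, h⟩ | ⟨_, h⟩ <;> rw [h] <;> simp only <;> omega

/-- `k` is the larger of the labels to the north and west of the square. -/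
def U1 (A : SDT r n) (a b k : ℕ) : Prop :=
  (A.labE (a, b + 1) = k ∨ A.labE (a + 1, b) = k) ∧ A.labE (a, b + 1) ≤ k ∧ A.labE (a + 1, b) ≤ k

/-- `k` is the smaller of the labels to the south and east of the square. -/
def U2 (A : SDT r n) (a b k : ℕ) : Prop :=
  (A.labE (a + 2, b + 1) = k ∨ A.labE (a + 1, b + 2) = k) ∧
    (k : ℕ∞) ≤ A.labE (a + 2, b + 1) ∧ (k : ℕ∞) ≤ A.labE (a + 1, b + 2)

theorem U1_unique (A : SDT r n) {a b k l : ℕ} (h : U1 A a b k) (h' : U1 A a b l) : k = l := by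
  obtain ⟨h1, h2, h3⟩ := h
  obtain ⟨h1', h2', h3'⟩ := h'
  have e1 : (k : ℕ∞) ≤ l := by rcases h1 with h | h <;> rw [← h] <;> assumption
  have e2 : (l : ℕ∞) ≤ k := by rcases h1' with h | h <;> rw [← h] <;> assumption
  exact_mod_cast le_antisymm e1 e2

theorem U2_unique (A : SDT r n) {a b k l : ℕ} (h : U2 A a b k) (h' : U2 A a b l) : k = l := by
  obtain ⟨h1, h2, h3⟩ := h
  obtain ⟨h1', h2', h3'⟩ := h'
  have e1 : (k : ℕ∞) ≤ l := by rcases h1' with h | h <;> rw [← h] <;> assumption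
  have e2 : (l : ℕ∞) ≤ k := by rcases h1 with h | h <;> rw [← h] <;> assumption
  exact_mod_cast le_antisymm e1 e2

theorem boxNE (A : SDT r n) {p q k : ℕ} (hf : FixedSq r (p + 1, q + 1)) :
    BoxedSet r {(p + 1, q + 1), vNE A p q k} ↔ p % 2 = 1 := by
  unfold FixedSq at hf
  simp only at hf
  unfold BoxedSet TypeX VariableSq
  rcases vNE_cases A p q k with ⟨_, _, h⟩ | ⟨_, h⟩ <;> rw [h] <;> constructor
  · rintro ⟨i, j, h1, h2⟩
    simp [Set.insert_subset_iff] at h1 h2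
    omega
  · intro hp
    exact ⟨p, q + 1, by simp only; omega, by simp [Set.insert_subset_iff]⟩
  · rintro ⟨i, j, h1, h2⟩
    simp [Set.insert_subset_iff] at h1 h2
    omega
  · intro hp
    exact ⟨p, q + 1, by simp only; omega, by simp [Set.insert_subset_iff]⟩

theorem boxSW (A : SDT r n) {p q k : ℕ} (hf : FixedSq r (p + 1, q + 1)) :
    BoxedSet r {(p + 1, q + 1), vSW A p q k} ↔ p % 2 = 0 := by
  unfold FixedSq at hf
  simp only at hf
  unfold BoxedSet TypeX VariableSq
  rcases vSW_cases A p q k with ⟨_, _, h⟩ | ⟨_, h⟩ <;> rw [h] <;> constructor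
  · rintro ⟨i, j, h1, h2⟩
    simp [Set.insert_subset_iff] at h1 h2
    omega
  · intro hp
    exact ⟨p + 1, q, by simp only; omega, by simp [Set.insert_subset_iff]⟩
  · rintro ⟨i, j, h1, h2⟩
    simp [Set.insert_subset_iff] at h1 h2
    omega
  · intro hp
    exact ⟨p + 1, q, by simp only; omega, by simp [Set.insert_subset_iff]⟩

theorem boxed_flip (A : SDT r n) {k : ℕ} (hk : 1 ≤ k) (hkn : k ≤ n) :
    BoxedSet r (suppD' A k) ↔ ¬ BoxedSet r (A.supp k) := by
  obtain ⟨p, q, hf, h⟩ := pos_cases A hk hkn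
  rcases h with ⟨h3, h4⟩ | ⟨h3, h4⟩ <;> rw [h3, h4, boxNE A hf, boxSW A hf] <;> omega

theorem user (A : SDT r n) {k : ℕ} (hk : 1 ≤ k) (hkn : k ≤ n) {x : ℕ × ℕ}
    (hx : ¬ FixedSq r x) {P : Finset (ℕ × ℕ)} (hP : P = A.supp k ∨ P = suppD' A k) (hxP : x ∈ P) :
    ∃ a b, x = (a + 1, b + 1) ∧ ((U1 A a b k ∧ (BoxedSet r P ↔ a % 2 = 1)) ∨
      (U2 A a b k ∧ (BoxedSet r P ↔ a % 2 = 0))) := by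
  obtain ⟨p, q, hf, h⟩ := pos_cases A hk hkn
  have h7 : A.labE (p + 1, q + 1) = k := by
    rw [← mem_supp_iff A hk]
    rcases h with ⟨h3, h4⟩ | ⟨h3, h4⟩ <;> rw [h3] <;> simp
  have h1 : x ≠ (p + 1, q + 1) := fun h => hx (h ▸ hf)
  have h9 : P = {(p + 1, q + 1), vNE A p q k} ∨ P = {(p + 1, q + 1), vSW A p q k} := by
    rcases h with ⟨h3, h4⟩ | ⟨h3, h4⟩ <;> rw [h3, h4] at hP <;> tauto
  rcases h9 with rfl | rfl
  · simp [h1] at hxP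
    rw [boxNE A hf]
    rcases vNE_cases A p q k with ⟨h, hp, e⟩ | ⟨h, e⟩
    · obtain ⟨p, rfl⟩ : ∃ p', p = p' + 1 := ⟨p - 1, by omega⟩
      refine ⟨p, q, by rw [hxP, e], Or.inr ⟨⟨Or.inl h7, h7.ge, h.le⟩, by omega⟩⟩
    · exact ⟨p, q + 1, by rw [hxP, e], Or.inl ⟨⟨Or.inr h7, h, h7.le⟩, Iff.rfl⟩⟩
  · simp [h1] at hxP
    rw [boxSW A hf]
    rcases vSW_cases A p q k with ⟨h, hp, e⟩ | ⟨h, e⟩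
    · obtain ⟨q, rfl⟩ : ∃ p', q = p' + 1 := ⟨q - 1, by omega⟩
      refine ⟨p, q, by rw [hxP, e], Or.inr ⟨⟨Or.inr h7, h.le, h7.ge⟩, Iff.rfl⟩⟩
    · exact ⟨p + 1, q, by rw [hxP, e], Or.inl ⟨⟨Or.inl h7, h7.le, h⟩, by omega⟩⟩

theorem supp_unique (A : SDT r n) {k l : ℕ} {x : ℕ × ℕ} (h : x ∈ A.supp k) (h' : x ∈ A.supp l) :
    k = l := by
  rw [mem_supp] at h h'
  exact h.2.symm.trans h'.2

theorem D'_disj_aux (A : SDT r n) {k l a b : ℕ} (hk : 1 ≤ k) (hkn : k ≤ n) (hl : 1 ≤ l)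
    (hln : l ≤ n) (hx : ¬ FixedSq r (a + 1, b + 1)) (h : (a + 1, b + 1) ∈ suppD' A k)
    (h' : (a + 1, b + 1) ∈ suppD' A l) (u1 : U1 A a b k) (u2 : U2 A a b l) : False := by
  have e1 : (k : ℕ∞) ≤ A.labE (a + 1, b + 1) := by
    rcases u1.1 with e | e <;> rw [← e]
    · exact col_le A _ _
    · exact row_le A _ _
  have e2 : A.labE (a + 1, b + 1) ≤ l := by
    rcases u2.1 with e | e <;> rw [← e]
    · exact col_le A _ _
    · exact row_le A _ _
  obtain ⟨m, hm⟩ : ∃ m : ℕ, A.labE (a + 1, b + 1) = m := by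
    have : A.labE (a + 1, b + 1) ≠ ⊤ := fun h => by
      rw [h] at e2; exact absurd (top_le_iff.1 e2) (ENat.natCast_ne_top l)
    exact ⟨_, (ENat.natCast_toNat this).symm⟩
  rw [hm] at e1 e2
  have e1' : k ≤ m := by exact_mod_cast e1
  have e2' : m ≤ l := by exact_mod_cast e2
  have hmem : (a + 1, b + 1) ∈ A.supp m := (mem_supp_iff A (by omega) _).2 hm
  obtain ⟨a', b', e, H⟩ := user A (k := m) (by omega) (by omega) hx (Or.inl rfl) hmem
  simp only [Prod.mk.injEq, add_left_inj] at e
  obtain ⟨rfl, rfl⟩ := e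
  rcases H with ⟨H, _⟩ | ⟨H, _⟩
  · obtain rfl := U1_unique A H u1
    exact var_not_both A hk hkn hx hmem h
  · obtain rfl := U2_unique A H u2
    exact var_not_both A hl hln hx hmem h'

theorem D'_unique (A : SDT r n) {k l : ℕ} (hk : 1 ≤ k) (hkn : k ≤ n) (hl : 1 ≤ l)
    (hln : l ≤ n) {x : ℕ × ℕ} (h : x ∈ suppD' A k) (h' : x ∈ suppD' A l) : k = l := by
  by_cases hx : FixedSq r x
  · rw [fixed_mem A hk hkn hx] at h
    rw [fixed_mem A hl hln hx] at h'
    exact supp_unique A h h'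
  · obtain ⟨a, b, rfl, H⟩ := user A hk hkn hx (Or.inr rfl) h
    obtain ⟨a', b', e, H'⟩ := user A hl hln hx (Or.inr rfl) h'
    simp only [Prod.mk.injEq, add_left_inj] at e
    obtain ⟨rfl, rfl⟩ := e
    rcases H with ⟨H, _⟩ | ⟨H, _⟩ <;> rcases H' with ⟨H', _⟩ | ⟨H', _⟩
    · exact U1_unique A H H'
    · exact (D'_disj_aux A hk hkn hl hln hx h h' H H').elim
    · exact (D'_disj_aux A hl hln hk hkn hx h' h H' H).elim
    · exact U2_unique A H H'

theorem D'_zero (A : SDT r n) : suppD' A 0 = ∅ := by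
  unfold suppD'
  rw [dif_neg]
  rintro ⟨s, i, j, hf, H⟩
  have hm : (i, j) ∈ A.supp 0 := by
    rcases H with ⟨h | h, _⟩ | ⟨h | h, _⟩ <;> rw [h] <;> simp
  rw [mem_supp] at hm
  have hp := A.pos_cells _ hm.1
  have hc := (A.core_zero _ hm.1).1 hm.2
  simp only at hp hc
  have z1 := labE_zero A (i - 1) (j + 1) (by omega)
  have z2 := labE_zero A (i + 1) (j - 1) (by omega)
  rw [z1, z2] at H
  simp at H

theorem D'_big (A : SDT r n) {k : ℕ} (hk : n < k) : suppD' A k = ∅ := by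
  unfold suppD'
  rw [dif_neg]
  rintro ⟨s, i, j, hf, H⟩
  have hm : (i, j) ∈ A.supp k := by
    rcases H with ⟨h | h, _⟩ | ⟨h | h, _⟩ <;> rw [h] <;> simp
  rw [mem_supp] at hm
  have := A.lab_le _ hm.1
  omega

theorem step_range (A : SDT r n) {k l : ℕ} (hk : 1 ≤ k) (hkn : k ≤ n) (h : cycStep A k l) :
    1 ≤ l ∧ l ≤ n := by
  rcases h with ⟨x, hx⟩ | ⟨x, hx⟩ <;> rw [Finset.mem_inter] at hx
  · obtain ⟨h1, h2⟩ := hx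
    have h3 := noncore A hk hkn h2
    rw [mem_supp] at h1
    have h4 := A.lab_le _ h1.1
    have h5 := A.core_zero _ h1.1
    omega
  · obtain ⟨h1, h2⟩ := hx
    constructor
    · by_contra h0
      obtain rfl : l = 0 := by omega
      rw [D'_zero] at h1
      simp at h1
    · by_contra h0
      rw [D'_big A (by omega)] at h1
      simp at h1

theorem step_symm (A : SDT r n) {k l : ℕ} (h : cycStep A k l) : cycStep A l k := by
  unfold cycStep at *
  rw [Finset.inter_comm (A.supp k), Finset.inter_comm (suppD' A k)]
  exact h.symm

theorem step_boxed_aux (A : SDT r n) {k l : ℕ} (hk : 1 ≤ k) (hkn : k ≤ n) (hl : 1 ≤ l)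
    (hln : l ≤ n) {x : ℕ × ℕ} (h1 : x ∈ A.supp l) (h2 : x ∈ suppD' A k) :
    BoxedSet r (A.supp k) ↔ BoxedSet r (A.supp l) := by
  by_cases hkl : k = l
  · rw [hkl]
  by_cases hx : FixedSq r x
  · rw [fixed_mem A hk hkn hx] at h2
    exact absurd (supp_unique A h2 h1) hkl
  · have hb := boxed_flip A hk hkn
    obtain ⟨a, b, rfl, H⟩ := user A hk hkn hx (Or.inr rfl) h2
    obtain ⟨a', b', e, H'⟩ := user A hl hln hx (Or.inl rfl) h1
    simp only [Prod.mk.injEq, add_left_inj] at e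
    obtain ⟨rfl, rfl⟩ := e
    rcases H with ⟨H, G⟩ | ⟨H, G⟩ <;> rcases H' with ⟨H', G'⟩ | ⟨H', G'⟩
    · exact absurd (U1_unique A H H') hkl
    · rw [G', ← not_iff_not, ← hb, G]; omega
    · rw [G', ← not_iff_not, ← hb, G]; omega
    · exact absurd (U2_unique A H H') hkl

theorem step_boxed (A : SDT r n) {k l : ℕ} (hk : 1 ≤ k) (hkn : k ≤ n) (h : cycStep A k l) :
    BoxedSet r (A.supp k) ↔ BoxedSet r (A.supp l) := by
  obtain ⟨hl, hln⟩ := step_range A hk hkn h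
  rcases h with ⟨x, hx⟩ | ⟨x, hx⟩ <;> rw [Finset.mem_inter] at hx
  · exact step_boxed_aux A hk hkn hl hln hx.1 hx.2
  · exact (step_boxed_aux A hl hln hk hkn hx.2 hx.1).symm

/-- Same labels on fixed squares. -/
def FE (A B : SDT r n) : Prop :=
  ∀ x, FixedSq r x → (x ∈ A.cells ↔ x ∈ B.cells) ∧ A.lab x = B.lab x

theorem FE.refl (A : SDT r n) : FE A A := fun _ _ => ⟨Iff.rfl, rfl⟩
theorem FE.symm {A B : SDT r n} (h : FE A B) : FE B A :=
  fun x hx => ⟨(h x hx).1.symm, (h x hx).2.symm⟩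
theorem FE.trans {A B C : SDT r n} (h : FE A B) (h' : FE B C) : FE A C :=
  fun x hx => ⟨(h x hx).1.trans (h' x hx).1, (h x hx).2.trans (h' x hx).2⟩

theorem FE.labE {A B : SDT r n} (h : FE A B) {x : ℕ × ℕ} (hx : FixedSq r x) :
    A.labE x = B.labE x := by
  unfold SDT.labE
  obtain ⟨h1, h2⟩ := h x hx
  simp only [h1, h2]

theorem FE.supp {A B : SDT r n} (h : FE A B) {x : ℕ × ℕ} (hx : FixedSq r x) (k : ℕ) :
    x ∈ A.supp k ↔ x ∈ B.supp k := by
  rw [mem_supp, mem_supp, (h x hx).1, (h x hx).2]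

theorem FE.dich {A B : SDT r n} (h : FE A B) {k : ℕ} (hk : 1 ≤ k) (hkn : k ≤ n) :
    (B.supp k = A.supp k ∧ suppD' B k = suppD' A k) ∨
    (B.supp k = suppD' A k ∧ suppD' B k = A.supp k) := by
  obtain ⟨p, q, hf, H⟩ := pos_cases A hk hkn
  obtain ⟨p', q', hf', H'⟩ := pos_cases B hk hkn
  have e : (p + 1, q + 1) = (p' + 1, q' + 1) := by
    have h1 : (p + 1, q + 1) ∈ A.supp k := by
      rcases H with ⟨h3, h4⟩ | ⟨h3, h4⟩ <;> rw [h3] <;> simp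
    rw [h.supp hf] at h1
    have n1 : (p + 1, q + 1) ≠ vNE B p' q' k := fun e => vNE_var B hf' (e ▸ hf)
    have n2 : (p + 1, q + 1) ≠ vSW B p' q' k := fun e => vSW_var B hf' (e ▸ hf)
    rcases H' with ⟨h3, h4⟩ | ⟨h3, h4⟩ <;> rw [h3, Finset.mem_insert, Finset.mem_singleton] at h1 <;>
      tauto
  simp only [Prod.mk.injEq, add_left_inj] at e
  obtain ⟨rfl, rfl⟩ := e
  have e1 : vNE B p q k = vNE A p q k := by
    unfold vNE
    rw [h.labE]
    unfold FixedSq at *; simp only at *; omega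
  have e2 : vSW B p q k = vSW A p q k := by
    unfold vSW
    rw [h.labE]
    unfold FixedSq at *; simp only at *; omega
  rw [e1, e2] at H'
  rcases H with ⟨h3, h4⟩ | ⟨h3, h4⟩ <;> rcases H' with ⟨h3', h4'⟩ | ⟨h3', h4'⟩ <;>
    rw [h3, h4, h3', h4'] <;> simp

theorem FE.step {A B : SDT r n} (h : FE A B) {k l : ℕ} (hk : 1 ≤ k) (hkn : k ≤ n)
    (hs : cycStep A k l) : cycStep B k l ∧
    ((B.supp k = A.supp k ∧ suppD' B k = suppD' A k ∧ B.supp l = A.supp l ∧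
      suppD' B l = suppD' A l) ∨
    (B.supp k = suppD' A k ∧ suppD' B k = A.supp k ∧ B.supp l = suppD' A l ∧
      suppD' B l = A.supp l)) := by
  obtain ⟨hl, hln⟩ := step_range A hk hkn hs
  have main : (B.supp k = A.supp k ∧ suppD' B k = suppD' A k ∧ B.supp l = A.supp l ∧
      suppD' B l = suppD' A l) ∨
    (B.supp k = suppD' A k ∧ suppD' B k = A.supp k ∧ B.supp l = suppD' A l ∧
      suppD' B l = A.supp l) := by
    by_cases hkl : k = l
    · subst hkl
      have := h.dich hk hkn
      tauto
    rcases h.dich hk hkn with ⟨a1, a2⟩ | ⟨a1, a2⟩ <;>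
    rcases h.dich hl hln with ⟨b1, b2⟩ | ⟨b1, b2⟩
    · tauto
    · exfalso
      rcases hs with ⟨x, hx⟩ | ⟨x, hx⟩ <;> rw [Finset.mem_inter] at hx
      · rw [← b2, ← a2] at hx
        exact hkl (D'_unique B hk hkn hl hln hx.2 hx.1)
      · rw [← b1, ← a1] at hx
        exact hkl (supp_unique B hx.2 hx.1)
    · exfalso
      rcases hs with ⟨x, hx⟩ | ⟨x, hx⟩ <;> rw [Finset.mem_inter] at hx
      · rw [← b1, ← a1] at hx
        exact hkl (supp_unique B hx.2 hx.1)
      · rw [← b2, ← a2] at hx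
        exact hkl (D'_unique B hk hkn hl hln hx.2 hx.1)
    · tauto
  refine ⟨?_, main⟩
  unfold cycStep at *
  rcases main with ⟨a, b, c, d⟩ | ⟨a, b, c, d⟩ <;> rw [a, b, c, d]
  · exact hs
  · exact hs.symm

theorem reach_range (A : SDT r n) {k l : ℕ} (hk : 1 ≤ k) (hkn : k ≤ n)
    (h : Relation.ReflTransGen (cycStep A) k l) : 1 ≤ l ∧ l ≤ n := by
  induction h with
  | refl => exact ⟨hk, hkn⟩
  | tail _ h ih => exact step_range A ih.1 ih.2 h

theorem FE.reach {A B : SDT r n} (hF : FE A B) {k l : ℕ} (hk : 1 ≤ k) (hkn : k ≤ n)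
    (h : Relation.ReflTransGen (cycStep A) k l) : Relation.ReflTransGen (cycStep B) k l := by
  induction h with
  | refl => exact .refl
  | tail h1 h ih =>
    have := reach_range A hk hkn h1
    exact ih.tail (hF.step this.1 this.2 h).1

theorem FE.cyc {A B : SDT r n} (hF : FE A B) {k : ℕ} (hk : 1 ≤ k) (hkn : k ≤ n) :
    cyc A k = cyc B k := by
  ext l
  exact ⟨fun h => ⟨h.1, h.2.1, hF.reach hk hkn h.2.2⟩,
    fun h => ⟨h.1, h.2.1, hF.symm.reach hk hkn h.2.2⟩⟩

theorem FE.isCycle {A B : SDT r n} (hF : FE A B) {c : Set ℕ} (h : IsCycle A c) : IsCycle B c := by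
  obtain ⟨k, h1, h2, rfl⟩ := h
  exact ⟨k, h1, h2, hF.cyc h1 h2⟩

theorem FE.cycle_dich {A B : SDT r n} (hF : FE A B) {c : Set ℕ} (h : IsCycle A c) :
    (∀ l ∈ c, B.supp l = A.supp l ∧ suppD' B l = suppD' A l) ∨
    (∀ l ∈ c, B.supp l = suppD' A l ∧ suppD' B l = A.supp l) := by
  obtain ⟨k, hk, hkn, rfl⟩ := h
  have hne : ∀ m, 1 ≤ m → m ≤ n → suppD' A m ≠ A.supp m := by
    intro m h1 h2 e
    have := boxed_flip A h1 h2
    rw [e] at this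
    tauto
  rcases hF.dich hk hkn with H | H
  · left
    rintro l ⟨_, _, hl⟩
    induction hl with
    | refl => exact H
    | tail h1 h ih =>
      have hr := reach_range A hk hkn h1
      have ih := ih hr.1 hr.2
      rcases (hF.step hr.1 hr.2 h).2 with g | g
      · exact g.2.2
      · exact absurd (g.1.symm.trans ih.1) (hne _ hr.1 hr.2)
  · right
    rintro l ⟨_, _, hl⟩
    induction hl with
    | refl => exact H
    | tail h1 h ih =>
      have hr := reach_range A hk hkn h1
      have ih := ih hr.1 hr.2
      rcases (hF.step hr.1 hr.2 h).2 with g | g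
      · exact absurd (ih.1.symm.trans g.1) (hne _ hr.1 hr.2)
      · exact g.2.2

theorem cycle_boxed {A : SDT r n} {c : Set ℕ} (h : IsCycle A c) {l m : ℕ} (hl : l ∈ c)
    (hm : m ∈ c) : BoxedSet r (A.supp l) ↔ BoxedSet r (A.supp m) := by
  obtain ⟨k, hk, hkn, rfl⟩ := h
  have : ∀ l ∈ cyc A k, (BoxedSet r (A.supp k) ↔ BoxedSet r (A.supp l)) := by
    rintro l ⟨_, _, hl⟩
    induction hl with
    | refl => exact Iff.rfl
    | tail h1 h ih =>
      have hr := reach_range A hk hkn h1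
      exact (ih hr.1 hr.2).trans (step_boxed A hr.1 hr.2 h)
  exact (this l hl).symm.trans (this m hm)

theorem cycle_closed {A : SDT r n} {c : Set ℕ} (h : IsCycle A c) {l m : ℕ} (hl : l ∈ c)
    (hs : cycStep A l m) : m ∈ c := by
  obtain ⟨k, hk, hkn, rfl⟩ := h
  obtain ⟨h1, h2, h3⟩ := hl
  have := step_range A h1 h2 hs
  exact ⟨this.1, this.2, h3.tail hs⟩

theorem cycle_range {A : SDT r n} {c : Set ℕ} (h : IsCycle A c) {l : ℕ} (hl : l ∈ c) :
    1 ≤ l ∧ l ≤ n := by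
  obtain ⟨k, hk, hkn, rfl⟩ := h
  exact ⟨hl.1, hl.2.1⟩

theorem isMT_FE {A B : SDT r n} {c : Set ℕ} (h : IsMT A B c) : FE A B := by
  have hs : ∀ k, 1 ≤ k → k ≤ n → ∀ x, FixedSq r x → (x ∈ B.supp k ↔ x ∈ A.supp k) := by
    intro k hk hkn x hx
    by_cases hc : k ∈ c
    · rw [h.1 k hc, fixed_mem A hk hkn hx]
    · rw [h.2 k hk hkn hc]
  have key : ∀ A B : SDT r n,
      (∀ k, 1 ≤ k → k ≤ n → ∀ x, FixedSq r x → (x ∈ B.supp k ↔ x ∈ A.supp k)) →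
      ∀ x, FixedSq r x → x ∈ A.cells → x ∈ B.cells ∧ B.lab x = A.lab x := by
    intro A B hs x hx hA
    by_cases h0 : A.lab x = 0
    · have h1 := (A.core_zero x hA).1 h0
      have h2 := A.pos_cells x hA
      have h3 : x ∈ B.cells := B.core_mem x.1 x.2 h2.1 h2.2 h1
      exact ⟨h3, by rw [h0, B.core_zero x h3]; exact h1⟩
    · have := (hs (A.lab x) (by omega) (A.lab_le x hA) x hx).2 ((mem_supp _ _ _).2 ⟨hA, rfl⟩)
      exact (mem_supp _ _ _).1 this
  intro x hx
  have k1 := key A B hs x hx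
  have k2 := key B A (fun k a b x hx => (hs k a b x hx).symm) x hx
  refine ⟨⟨fun h => (k1 h).1, fun h => (k2 h).1⟩, ?_⟩
  by_cases hA : x ∈ A.cells
  · exact (k1 hA).2.symm
  · have hB : x ∉ B.cells := fun h => hA (k2 h).1
    rw [A.lab_outside x hA, B.lab_outside x hB]

theorem cells_le {A B : SDT r n} (h : ∀ k, 1 ≤ k → k ≤ n → A.supp k = B.supp k) {x : ℕ × ℕ}
    (hA : x ∈ A.cells) : x ∈ B.cells ∧ B.lab x = A.lab x := by
  by_cases h0 : A.lab x = 0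
  · have h1 := (A.core_zero x hA).1 h0
    have h2 := A.pos_cells x hA
    have h3 : x ∈ B.cells := B.core_mem x.1 x.2 h2.1 h2.2 h1
    exact ⟨h3, by rw [h0, B.core_zero x h3]; exact h1⟩
  · have : x ∈ A.supp (A.lab x) := (mem_supp _ _ _).2 ⟨hA, rfl⟩
    rw [h _ (by omega) (A.lab_le x hA)] at this
    exact (mem_supp _ _ _).1 this

theorem sdt_ext {A B : SDT r n} (h : ∀ k, 1 ≤ k → k ≤ n → A.supp k = B.supp k) : A = B := by
  have h' : ∀ k, 1 ≤ k → k ≤ n → B.supp k = A.supp k := fun k a b => (h k a b).symm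
  have e1 : A.cells = B.cells := by
    ext x
    exact ⟨fun hx => (cells_le h hx).1, fun hx => (cells_le h' hx).1⟩
  have e2 : A.lab = B.lab := by
    funext x
    by_cases hA : x ∈ A.cells
    · exact (cells_le h hA).2.symm
    · rw [A.lab_outside x hA, B.lab_outside x (e1 ▸ hA)]
  cases A; cases B
  simp only at e1 e2
  subst e1 e2
  rfl

open Classical in
theorem glue {A B : SDT r n} (hF : FE A B) {U : Set ℕ} (hU : ∀ l ∈ U, 1 ≤ l ∧ l ≤ n)
    (hc : ∀ k l, k ∈ U → cycStep A k l → l ∈ U) :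
    ∃ C : SDT r n, (∀ l ∈ U, C.supp l = B.supp l) ∧
      ∀ l, 1 ≤ l → l ≤ n → l ∉ U → C.supp l = A.supp l := by
  set σ : ℕ × ℕ → Prop := fun x => ∃ l ∈ U, x ∈ A.supp l ∨ x ∈ suppD' A l with hσ
  set cells : Finset (ℕ × ℕ) :=
    (A.cells ∪ B.cells).filter (fun x => if σ x then x ∈ B.cells else x ∈ A.cells) with hcells
  set lab : ℕ × ℕ → ℕ := fun x => if σ x then B.lab x else A.lab x with hlab
  have agB : ∀ x, σ x → (x ∈ cells ↔ x ∈ B.cells) ∧ lab x = B.lab x := by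
    intro x hx
    simp only [hcells, hlab, Finset.mem_filter, Finset.mem_union, if_pos hx]
    tauto
  have agA : ∀ x, ¬ σ x → (x ∈ cells ↔ x ∈ A.cells) ∧ lab x = A.lab x := by
    intro x hx
    simp only [hcells, hlab, Finset.mem_filter, Finset.mem_union, if_neg hx]
    tauto
  have ag : ∀ x, ((x ∈ cells ↔ x ∈ A.cells) ∧ lab x = A.lab x) ∨
      ((x ∈ cells ↔ x ∈ B.cells) ∧ lab x = B.lab x) := by
    intro x
    by_cases hx : σ x
    · exact Or.inr (agB x hx)
    · exact Or.inl (agA x hx)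
  have agf : ∀ x, FixedSq r x → ((x ∈ cells ↔ x ∈ A.cells) ∧ lab x = A.lab x) ∧
      ((x ∈ cells ↔ x ∈ B.cells) ∧ lab x = B.lab x) := by
    intro x hx
    have h1 := hF x hx
    rcases ag x with h | h
    · exact ⟨h, h.1.trans h1.1, h.2.trans h1.2⟩
    · exact ⟨⟨h.1.trans h1.1.symm, h.2.trans h1.2.symm⟩, h⟩
  have ag1 : ∀ x, ∃ X : SDT r n, (x ∈ cells ↔ x ∈ X.cells) ∧ lab x = X.lab x := by
    intro x
    rcases ag x with h | h
    · exact ⟨A, h⟩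
    · exact ⟨B, h⟩
  have ag2 : ∀ x y : ℕ × ℕ, x.1 + x.2 + 1 = y.1 + y.2 →
      ∃ X : SDT r n, ((x ∈ cells ↔ x ∈ X.cells) ∧ lab x = X.lab x) ∧
        ((y ∈ cells ↔ y ∈ X.cells) ∧ lab y = X.lab y) := by
    intro x y hxy
    by_cases hx : FixedSq r x
    · rcases ag y with h | h
      · exact ⟨A, (agf x hx).1, h⟩
      · exact ⟨B, (agf x hx).2, h⟩
    · have hy : FixedSq r y := by unfold FixedSq at *; omega
      rcases ag x with h | h
      · exact ⟨A, h, (agf y hy).1⟩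
      · exact ⟨B, h, (agf y hy).2⟩
  have suppU : ∀ k ∈ U, ∀ x, (x ∈ cells ∧ lab x = k) ↔ x ∈ B.supp k := by
    intro k hk x
    obtain ⟨h1, h2⟩ := hU k hk
    by_cases hx : σ x
    · rw [(agB x hx).1, (agB x hx).2, mem_supp]
    · rw [(agA x hx).1, (agA x hx).2, ← mem_supp]
      constructor
      · intro h
        exact absurd ⟨k, hk, Or.inl h⟩ hx
      · intro h
        exfalso
        apply hx
        rcases hF.dich h1 h2 with e | e <;> rw [e.1] at h
        · exact ⟨k, hk, Or.inl h⟩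
        · exact ⟨k, hk, Or.inr h⟩
  have suppA : ∀ k, 1 ≤ k → k ≤ n → k ∉ U → ∀ x, (x ∈ cells ∧ lab x = k) ↔ x ∈ A.supp k := by
    intro k h1 h2 hk x
    by_cases hx : σ x
    · rw [(agB x hx).1, (agB x hx).2, ← mem_supp]
      obtain ⟨l, hl, hx⟩ := hx
      obtain ⟨hl1, hl2⟩ := hU l hl
      constructor
      · intro h
        rcases hF.dich h1 h2 with e | e <;> rw [e.1] at h
        · exact h
        · exfalso
          rcases hx with hx | hx
          · exact hk (hc l k hl (Or.inr ⟨x, Finset.mem_inter.2 ⟨h, hx⟩⟩))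
          · exact hk (D'_unique A h1 h2 hl1 hl2 h hx ▸ hl)
      · intro h
        exfalso
        rcases hx with hx | hx
        · exact hk (supp_unique A h hx ▸ hl)
        · exact hk (hc l k hl (Or.inl ⟨x, Finset.mem_inter.2 ⟨h, hx⟩⟩))
    · rw [(agA x hx).1, (agA x hx).2, mem_supp]
  have dom : ∀ (k : ℕ) (X : SDT r n), 1 ≤ k → k ≤ n →
      (∀ x, (x ∈ cells ∧ lab x = k) ↔ x ∈ X.supp k) →
      ∃ a b : ℕ × ℕ, a ∈ cells ∧ b ∈ cells ∧
      (b = (a.1 + 1, a.2) ∨ b = (a.1, a.2 + 1)) ∧ lab a = k ∧ lab b = k ∧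
      ∀ c ∈ cells, lab c = k → c = a ∨ c = b := by
    intro k X h1 h2 h
    obtain ⟨a, b, ha, hb, hab, la, lb, hu⟩ := X.domino k h1 h2
    have ha' := (h a).2 ((mem_supp _ _ _).2 ⟨ha, la⟩)
    have hb' := (h b).2 ((mem_supp _ _ _).2 ⟨hb, lb⟩)
    refine ⟨a, b, ha'.1, hb'.1, hab, ha'.2, hb'.2, fun c h3 h4 => ?_⟩
    have := (mem_supp _ _ _).1 ((h c).1 ⟨h3, h4⟩)
    exact hu c this.1 this.2
  refine ⟨⟨cells, lab, ?_, ?_, ?_, ?_, ?_, ?_, ?_, ?_, ?_, ?_⟩, ?_, ?_⟩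
  · intro x hx
    obtain ⟨X, h1, h2⟩ := ag1 x
    rw [h2]; exact X.lab_outside x (fun h => hx (h1.2 h))
  · intro x hx
    obtain ⟨X, h1, h2⟩ := ag1 x
    exact X.pos_cells x (h1.1 hx)
  · intro i j h hj
    obtain ⟨X, h1, h2⟩ := ag2 (i, j) (i, j + 1) (by simp only; omega)
    exact h1.1.2 (X.young_row i j (h2.1.1 h) hj)
  · intro i j h hj
    obtain ⟨X, h1, h2⟩ := ag2 (i, j) (i + 1, j) (by simp only; omega)
    exact h1.1.2 (X.young_col i j (h2.1.1 h) hj)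
  · intro i j a b c
    obtain ⟨X, h1, h2⟩ := ag1 (i, j)
    exact h1.2 (X.core_mem i j a b c)
  · intro x hx
    obtain ⟨X, h1, h2⟩ := ag1 x
    rw [h2]; exact X.core_zero x (h1.1 hx)
  · intro x hx
    obtain ⟨X, h1, h2⟩ := ag1 x
    rw [h2]; exact X.lab_le x (h1.1 hx)
  · intro k h1 h2
    by_cases hk : k ∈ U
    · exact dom k B h1 h2 (suppU k hk)
    · exact dom k A h1 h2 (suppA k h1 h2 hk)
  · intro i j a b
    obtain ⟨X, h1, h2⟩ := ag2 (i, j) (i, j + 1) (by simp only; omega)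
    rw [h1.2, h2.2]
    exact X.row_mono i j (h1.1.1 a) (h2.1.1 b)
  · intro i j a b
    obtain ⟨X, h1, h2⟩ := ag2 (i, j) (i + 1, j) (by simp only; omega)
    rw [h1.2, h2.2]
    exact X.col_mono i j (h1.1.1 a) (h2.1.1 b)
  · intro l hl
    ext x
    rw [mem_supp]
    exact suppU l hl x
  · intro l h1 h2 hl
    ext x
    rw [mem_supp]
    exact suppA l h1 h2 hl x

theorem cells_transfer {X Y B B' : SDT r n} {c : Set ℕ}
    (h1 : ∀ l ∈ c, B'.supp l = X.supp l) (h2 : ∀ l, 1 ≤ l → l ≤ n → l ∉ c → B'.supp l = B.supp l)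
    (h3 : ∀ l ∈ c, B.supp l = Y.supp l) (h4 : ∀ l, 1 ≤ l → l ≤ n → l ∉ c → X.supp l = Y.supp l)
    (he : B'.cells = B.cells) : X.cells ⊆ Y.cells := by
  intro x hx
  by_cases h0 : X.lab x = 0
  · have a := (X.core_zero x hx).1 h0
    have b := X.pos_cells x hx
    exact Y.core_mem x.1 x.2 b.1 b.2 a
  have hm : x ∈ X.supp (X.lab x) := (mem_supp _ _ _).2 ⟨hx, rfl⟩
  by_cases hl : X.lab x ∈ c
  · rw [← h1 _ hl] at hm
    have hB : x ∈ B.cells := he ▸ ((mem_supp _ _ _).1 hm).1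
    have hmB : x ∈ B.supp (B.lab x) := (mem_supp _ _ _).2 ⟨hB, rfl⟩
    by_cases hl' : B.lab x ∈ c
    · rw [h3 _ hl'] at hmB
      exact ((mem_supp _ _ _).1 hmB).1
    · exfalso
      have hB0 : B.lab x ≠ 0 := by
        intro e
        have a := (B.core_zero x hB).1 e
        exact h0 ((X.core_zero x hx).2 a)
      rw [← h2 _ (by omega) (B.lab_le x hB) hl'] at hmB
      exact hl' (supp_unique B' hmB hm ▸ hl)
  · rw [h4 _ (by omega) (X.lab_le x hx) hl] at hm
    exact ((mem_supp _ _ _).1 hm).1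

theorem nco_aux {X Y B : SDT r n} {c : Set ℕ} (hXB : FE B X) (hc : IsCycle B c)
    (h1 : ∀ l ∈ c, X.supp l = suppD' B l) (h3 : ∀ l ∈ c, B.supp l = Y.supp l)
    (h4 : ∀ l, 1 ≤ l → l ≤ n → l ∉ c → X.supp l = Y.supp l) (hne : X.cells ≠ Y.cells) :
    NonCoreOpen B c := by
  refine ⟨hc, ?_⟩
  obtain ⟨B', g1, g2⟩ := glue hXB (U := c) (fun l hl => cycle_range hc hl)
    (fun k l hk hs => cycle_closed hc hk hs)
  refine ⟨B', ⟨fun l hl => (g1 l hl).trans (h1 l hl), g2⟩, fun he => hne ?_⟩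
  apply Finset.Subset.antisymm
  · exact cells_transfer g1 g2 h3 h4 he
  · exact cells_transfer (B := B') (B' := B) h3 (fun l a b d => (g2 l a b d).symm) g1
      (fun l a b d => (h4 l a b d).symm) he.symm

theorem FE.nco {A B : SDT r n} (hF : FE A B) {c : Set ℕ} (h : NonCoreOpen A c) :
    NonCoreOpen B c := by
  obtain ⟨hc, A', hMT, hne⟩ := h
  have hA' := isMT_FE hMT
  have hcB := hF.isCycle hc
  rcases hF.cycle_dich hc with H | H
  · exact nco_aux (X := A') (Y := A) (hF.symm.trans hA') hcB
      (fun l hl => (hMT.1 l hl).trans (H l hl).2.symm) (fun l hl => (H l hl).1) hMT.2 hne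
  · exact nco_aux (X := A) (Y := A') hF.symm hcB
      (fun l hl => (H l hl).2.symm) (fun l hl => (H l hl).1.trans (hMT.1 l hl).symm)
      (fun l a b d => (hMT.2 l a b d).symm) hne.symm

/-- The step relation. -/
def R (A B : SDT r n) : Prop := ∃ c, NonCoreOpen A c ∧ IsMT A B c

theorem eqv_inv {A B : SDT r n} (h : Relation.EqvGen R A B) :
    FE A B ∧ ∀ l, 1 ≤ l → l ≤ n → (∀ c, NonCoreOpen A c → l ∉ c) → A.supp l = B.supp l := by
  induction h with
  | rel A B h =>
    obtain ⟨c, h1, h2⟩ := h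
    exact ⟨isMT_FE h2, fun l a b d => (h2.2 l a b (d c h1)).symm⟩
  | refl A => exact ⟨FE.refl A, fun _ _ _ _ => rfl⟩
  | symm A B _ ih =>
    exact ⟨ih.1.symm, fun l a b d => (ih.2 l a b (fun c hc => d c (ih.1.nco hc))).symm⟩
  | trans A B C _ _ ih1 ih2 =>
    exact ⟨ih1.1.trans ih2.1, fun l a b d => (ih1.2 l a b d).trans
      (ih2.2 l a b (fun c hc => d c (ih1.1.symm.nco hc)))⟩

open Classical in
/-- Labels in unboxed non-core open cycles. -/
noncomputable def bad (A : SDT r n) : Finset ℕ :=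
  (Finset.Icc 1 n).filter (fun l => (∃ c, NonCoreOpen A c ∧ l ∈ c) ∧ ¬ BoxedSet r (A.supp l))

theorem exists_special (m : ℕ) : ∀ A : SDT r n, (bad A).card = m →
    ∃ B, Relation.EqvGen R A B ∧ SomewhatSpecial B := by
  induction m using Nat.strong_induction_on with
  | _ m ih =>
    intro A hA
    by_cases hS : SomewhatSpecial A
    · exact ⟨A, .refl A, hS⟩
    · unfold SomewhatSpecial at hS
      push Not at hS
      obtain ⟨c, hc, l, hl, hbox⟩ := hS
      have hc' := hc
      obtain ⟨hcy, B, hMT, _⟩ := hc'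
      have hF := isMT_FE hMT
      have hlr := cycle_range hcy hl
      have hb : ∀ k ∈ c, BoxedSet r (B.supp k) := by
        intro k hk
        have hkr := cycle_range hcy hk
        rw [hMT.1 k hk, boxed_flip A hkr.1 hkr.2, cycle_boxed hcy hk hl]
        exact hbox
      have hlt : (bad B).card < m := by
        rw [← hA]
        apply Finset.card_lt_card
        rw [Finset.ssubset_iff_of_subset]
        · refine ⟨l, ?_, ?_⟩
          · simp only [bad, Finset.mem_filter, Finset.mem_Icc]
            exact ⟨hlr, ⟨c, hc, hl⟩, hbox⟩
          · simp only [bad, Finset.mem_filter, Finset.mem_Icc]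
            exact fun h => h.2.2 (hb l hl)
        · intro k
          simp only [bad, Finset.mem_filter, Finset.mem_Icc]
          rintro ⟨hk, ⟨d, hd, hkd⟩, hnb⟩
          refine ⟨hk, ⟨d, hF.symm.nco hd, hkd⟩, ?_⟩
          have : k ∉ c := fun h => hnb (hb k h)
          rwa [← hMT.2 k hk.1 hk.2 this]
      obtain ⟨C, h1, h2⟩ := ih _ hlt B rfl
      exact ⟨C, .trans _ _ _ (.rel _ _ ⟨c, hc, hMT⟩) h1, h2⟩

theorem special_unique {A B : SDT r n} (h : Relation.EqvGen R A B) (hA : SomewhatSpecial A)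
    (hB : SomewhatSpecial B) : A = B := by
  obtain ⟨hF, hs⟩ := eqv_inv h
  apply sdt_ext
  intro k h1 h2
  by_cases hk : ∃ c, NonCoreOpen A c ∧ k ∈ c
  · obtain ⟨c, hc, hkc⟩ := hk
    rcases hF.dich h1 h2 with e | e
    · exact e.1.symm
    · exfalso
      have a := hA c hc k hkc
      have b := hB c (hF.nco hc) k hkc
      rw [e.1, boxed_flip A h1 h2] at b
      exact b a
  · push Not at hk
    exact hs k h1 h2 hk

end SDTaux

/-- In a family of rank-`r` domino tableaux obtained from one another by moving
through sets of non-core open cycles, there is exactly one somewhat special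
tableau. -/
theorem exists_unique_somewhatSpecial (r n : ℕ) (T : SDT r n) :
    ∃! T' : SDT r n,
      Relation.EqvGen (fun A B : SDT r n => ∃ c, NonCoreOpen A c ∧ IsMT A B c) T T' ∧
      SomewhatSpecial T' := by
  obtain ⟨B, h1, h2⟩ := SDTaux.exists_special _ T rfl
  refine ⟨B, ⟨h1, h2⟩, ?_⟩
  rintro C ⟨h3, h4⟩
  exact SDTaux.special_unique (.trans _ _ _ (.symm _ _ h3) h1) h4 h2
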